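/- arXiv:2002.00648 — 4 statements merged into one kernel-verified Lean document; each statement's English description precedes it below -/
import Mathlib

section
/- Let a and n be integers with a ≥ 2 and n ≥ 2. Then either there exists a prime r such that r divides aⁿ − (−1)ⁿ and r does not divide aⁱ − (−1)ⁱ for all integers i with 1 ≤ i < n, or one of the following holds: (1) n = 3 and a = 2; (2) n = 2 and a − 1 is a power of 2. -/
open Polynomial in
lemma zs_bounds (m : ℕ) (hm : m ≠ 0) (c : ℤ) (hc : 1 ≤ |c|) :
    (|c| - 1) ^ m.totient ≤ |(cyclotomic m ℤ).eval c| ∧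
    |(cyclotomic m ℤ).eval c| ≤ (|c| + 1) ^ m.totient := by
  have h1 : (((|(cyclotomic m ℤ).eval c| : ℤ)) : ℝ) = ∏ μ ∈ primitiveRoots m ℂ, ‖(c : ℂ) - μ‖ := by
    have h2 : (((cyclotomic m ℤ).eval c : ℤ) : ℂ) = (cyclotomic m ℂ).eval (c : ℂ) := by
      rw [← map_cyclotomic_int m ℂ, eval_intCast_map]; simp
    rw [cyclotomic_eq_prod_X_sub_primitiveRoots (Complex.isPrimitiveRoot_exp m hm),
      eval_prod] at h2
    simp only [eval_sub, eval_X, eval_C] at h2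
    rw [← norm_prod, ← h2, Complex.norm_intCast, Int.cast_abs]
  have hμ : ∀ μ ∈ primitiveRoots m ℂ, ((|c| : ℤ) : ℝ) - 1 ≤ ‖(c : ℂ) - μ‖ ∧
      ‖(c : ℂ) - μ‖ ≤ ((|c| : ℤ) : ℝ) + 1 := by
    intro μ h
    have h3 : ‖μ‖ = 1 := ((mem_primitiveRoots (Nat.pos_of_ne_zero hm)).1 h).norm'_eq_one hm
    have h4 : ‖(c : ℂ)‖ = ((|c| : ℤ) : ℝ) := by rw [Complex.norm_intCast, Int.cast_abs]
    rw [← h4, ← h3]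
    exact ⟨norm_sub_norm_le _ _, norm_sub_le _ _⟩
  have hc' : (0 : ℝ) ≤ ((|c| : ℤ) : ℝ) - 1 := by
    have : ((1 : ℤ) : ℝ) ≤ ((|c| : ℤ) : ℝ) := by exact_mod_cast hc
    push_cast at this ⊢
    linarith
  constructor
  · have : ((((|c| - 1) ^ m.totient : ℤ)) : ℝ) ≤ ((|(cyclotomic m ℤ).eval c| : ℤ) : ℝ) := by
      rw [h1, ← Complex.card_primitiveRoots, Int.cast_pow, Int.cast_sub, Int.cast_one,
        ← Finset.prod_const]
      exact Finset.prod_le_prod (fun _ _ => hc') (fun μ h => (hμ μ h).1)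
    exact_mod_cast this
  · have : ((|(cyclotomic m ℤ).eval c| : ℤ) : ℝ) ≤ ((((|c| + 1) ^ m.totient : ℤ)) : ℝ) := by
      rw [h1, ← Complex.card_primitiveRoots, Int.cast_pow, Int.cast_add, Int.cast_one,
        ← Finset.prod_const]
      exact Finset.prod_le_prod (fun _ _ => norm_nonneg _) (fun μ h => (hμ μ h).2)
    exact_mod_cast this

open Polynomial in
lemma zs_expand (p j m : ℕ) (hp : p.Prime) (b : ℤ) :
    (cyclotomic (p ^ (j + 1) * m) ℤ).eval b = (cyclotomic (m * p) ℤ).eval (b ^ p ^ j) := by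
  induction j generalizing b with
  | zero => simp [mul_comm]
  | succ j ih =>
    have h : p ∣ p ^ (j + 1) * m := Dvd.dvd.mul_right (dvd_pow_self p (by omega)) m
    have := cyclotomic_expand_eq_cyclotomic hp h ℤ
    rw [show p ^ (j + 1 + 1) * m = p ^ (j + 1) * m * p by ring, ← this, expand_eval, ih,
      ← pow_mul]
    congr 2
    ring

lemma zs_num5 (A : ℤ) (hA : 2 ≤ A) (p : ℕ) (hp : 5 ≤ p) : (p : ℤ) * (A + 1) + 1 < A ^ p := by
  induction p, hp using Nat.le_induction with
  | base =>
    have h2 : 4 ≤ A ^ 2 := by nlinarith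
    have h4 : 16 ≤ A ^ 4 := by nlinarith
    push_cast
    nlinarith
  | succ k hk ih =>
    rw [pow_succ]
    have hk' : (5 : ℤ) ≤ k := by exact_mod_cast hk
    push_cast
    have : 0 < A ^ k := by positivity
    nlinarith

open Polynomial in
lemma zs_lower (a : ℤ) (ha : 2 ≤ a) (n p : ℕ) (hn : 3 ≤ n) (hp : p.Prime) (hpn : p ∣ n)
    (hmax : ∀ q : ℕ, q.Prime → q ∣ n → q ≤ p) (hex : ¬ (n = 3 ∧ a = 2)) :
    (p : ℤ) < (cyclotomic n ℤ).eval (-a) := by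
  obtain ⟨k, m, hpm, hnk⟩ := Nat.exists_eq_pow_mul_and_not_dvd (show n ≠ 0 by omega) p hp.ne_one
  have hm0 : m ≠ 0 := by rintro rfl; simp at hpm
  obtain ⟨j, rfl⟩ : ∃ j, k = j + 1 := by
    rcases k with _ | j
    · simp at hnk; subst hnk; exact absurd hpn hpm
    · exact ⟨j, rfl⟩
  have hpos : 0 < (cyclotomic n ℤ).eval (-a) := cyclotomic_pos (by omega) _
  by_contra hle
  push Not at hle
  set N := (cyclotomic n ℤ).eval (-a) with hN
  set c : ℤ := (-a) ^ p ^ j with hc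
  have hcA : |c| = a ^ p ^ j := by rw [hc, abs_pow, abs_neg, abs_of_pos (by omega)]
  set A : ℤ := a ^ p ^ j with hA
  have hAa : a ≤ A := by
    calc a = a ^ 1 := (pow_one a).symm
      _ ≤ A := pow_le_pow_right₀ (by omega) (Nat.pos_of_ne_zero (pow_ne_zero _ hp.ne_zero))
  have key : (cyclotomic m ℤ).eval (c ^ p) = N * (cyclotomic m ℤ).eval c := by
    have := congrArg (eval c) (cyclotomic_expand_eq_cyclotomic_mul hp hpm ℤ)
    rw [expand_eval, eval_mul] at this
    rw [this, hN, hnk, zs_expand p j m hp]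
  have hcp : |c ^ p| = A ^ p := by rw [abs_pow, hcA]
  have hAp : 1 ≤ A ^ p := one_le_pow₀ (by omega)
  have b1 := (zs_bounds m hm0 (c ^ p) (by rw [hcp]; exact hAp)).1
  have b2 := (zs_bounds m hm0 c (by rw [hcA]; omega)).2
  rw [key, abs_mul, hcp, abs_of_pos hpos] at b1
  rw [hcA] at b2
  have ht : 1 ≤ m.totient := Nat.totient_pos.2 (Nat.pos_of_ne_zero hm0)
  have main : (A ^ p - 1) ^ m.totient ≤ p * (A + 1) ^ m.totient :=
    b1.trans (mul_le_mul hle b2 (abs_nonneg _) (by positivity))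
  have hp2 := hp.two_le
  have big : ¬ ((p : ℤ) * (A + 1) + 1 < A ^ p) := by
    intro hlt
    have h1 : ((p : ℤ) * (A + 1)) ^ m.totient < (A ^ p - 1) ^ m.totient :=
      pow_lt_pow_left₀ (by linarith) (by positivity) (by omega)
    rw [mul_pow] at h1
    have h2 : (p : ℤ) ≤ (p : ℤ) ^ m.totient := by
      calc (p : ℤ) = (p : ℤ) ^ 1 := (pow_one _).symm
        _ ≤ _ := pow_le_pow_right₀ (by exact_mod_cast hp.one_le) ht
    have h3 : 0 ≤ (A + 1) ^ m.totient := by positivity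
    nlinarith
  have hp5 : p < 5 := by
    by_contra h
    exact big (zs_num5 A (by omega) p (by omega))
  have hp23 : p = 2 ∨ p = 3 := by
    interval_cases p
    · simp
    · simp
    · exact absurd hp (by norm_num)
  rcases hp23 with rfl | rfl
  · have hm1 : m = 1 := by
      by_contra hne
      obtain ⟨q, hq, hqm⟩ := Nat.exists_prime_and_dvd hne
      have := hmax q hq (hnk ▸ hqm.mul_left _)
      have := hq.two_le
      have : q = 2 := by omega
      exact hpm (this ▸ hqm)
    subst hm1
    have hj : 1 ≤ j := by
      by_contra h
      have : j = 0 := by omega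
      subst this
      omega
    have hA4 : 4 ≤ A := by
      calc (4 : ℤ) ≤ a ^ 2 := by nlinarith
        _ ≤ A := pow_le_pow_right₀ (by omega) (by
          calc 2 = 2 ^ 1 := rfl
            _ ≤ 2 ^ j := Nat.pow_le_pow_right (by norm_num) hj)
    apply big
    push_cast
    nlinarith
  · have hA2 : A = 2 := by
      by_contra h
      have : 3 ≤ A := by omega
      apply big
      push_cast
      nlinarith [mul_self_nonneg A, mul_nonneg (show 0 ≤ A - 3 by omega) (mul_self_nonneg A)]
    have ha2 : a = 2 := by omega
    have hj : j = 0 := by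
      by_contra h
      have : a ^ 1 < A := pow_lt_pow_right₀ (by omega) (Nat.one_lt_pow h (by norm_num))
      rw [pow_one] at this
      omega
    subst hj
    rw [hA2] at main
    norm_num at main
    have ht1 : m.totient = 1 := by
      by_contra h
      obtain ⟨t, ht⟩ : ∃ t, m.totient = t + 2 := ⟨m.totient - 2, by omega⟩
      rw [ht, pow_add, pow_add] at main
      have : (3 : ℤ) ^ t ≤ 7 ^ t := pow_le_pow_left₀ (by norm_num) (by norm_num) t
      have : (0 : ℤ) < 3 ^ t := by positivity
      omega
    rcases Nat.totient_eq_one_iff.1 ht1 with rfl | rfl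
    · exact hex ⟨by simpa using hnk, ha2⟩
    · have : n = 6 := by simpa using hnk
      rw [hN, this, cyclotomic_six, ha2] at hle
      norm_num at hle

open Polynomial in
lemma zs_sq (b : ℤ) (n p : ℕ) (hn : 3 ≤ n) (hp : p.Prime) (hpn : p ∣ n)
    (h4 : p = 2 → 4 ∣ n) (hb1 : 2 ≤ |b|)
    (hb : (p : ℤ) ∣ b ^ (n / p) - 1) : ¬ (p : ℤ) ^ 2 ∣ (cyclotomic n ℤ).eval b := by
  intro hdvd
  obtain ⟨d, rfl⟩ := hpn
  rw [Nat.mul_div_cancel_left d hp.pos] at hb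
  have hd0 : d ≠ 0 := by rintro rfl; simp at hn
  have h1 := X_pow_sub_one_mul_cyclotomic_dvd_X_pow_sub_one_of_dvd ℤ (d := d) (n := p * d)
    (by rw [Nat.mem_properDivisors]
        exact ⟨dvd_mul_left _ _, by nlinarith [hp.two_le, Nat.pos_of_ne_zero hd0]⟩)
  have h2 := eval_dvd (x := b) h1
  simp only [eval_mul, eval_sub, eval_pow, eval_X, eval_one] at h2
  rw [show b ^ (p * d) - 1 = (b ^ d - 1) * ∑ i ∈ Finset.range p, (b ^ d) ^ i by
    rw [mul_geom_sum, ← pow_mul, mul_comm p d]] at h2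
  have hne : b ^ d - 1 ≠ 0 := by
    intro h
    have h3 : |b| ^ d = 1 := by rw [← abs_pow, show b ^ d = 1 by linarith, abs_one]
    have : 1 < |b| ^ d := one_lt_pow₀ (by omega) hd0
    omega
  have h3 := hdvd.trans ((mul_dvd_mul_iff_left hne).1 h2)
  obtain ⟨y, hy⟩ := hb
  rcases hp.eq_two_or_odd' with rfl | hodd
  · obtain ⟨e, he⟩ : 2 ∣ d := by have := h4 rfl; omega
    simp only [Finset.sum_range_succ, Finset.sum_range_zero, pow_zero, pow_one] at h3
    rw [he, mul_comm 2 e, pow_mul] at h3 hy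
    push_cast at h3 hy
    have := Int.emod_two_eq_zero_or_one (b ^ e)
    rcases Int.even_or_odd' (b ^ e) with ⟨k, hk | hk⟩ <;> rw [hk] at h3 hy <;> ring_nf at h3 hy <;> omega
  · have h5 := odd_sq_dvd_geom_sum₂_sub (1 : ℤ) y hodd
    have hx : (1 : ℤ) + p * y = b ^ d := by linarith
    simp only [one_pow, mul_one, hx] at h5
    have h6 := (dvd_sub_right h3).1 h5
    rw [sq] at h6
    have h7 : (p * p) ∣ p * 1 := by rw [mul_one]; exact_mod_cast h6
    exact hp.one_lt.ne' (Nat.dvd_one.1 (Nat.dvd_of_mul_dvd_mul_left hp.pos h7))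

open Polynomial in
lemma zs_main (a : ℤ) (ha : 2 ≤ a) (n : ℕ) (hn : 3 ≤ n) (hex : ¬ (n = 3 ∧ a = 2)) :
    ∃ r : ℕ, ∃ _ : Fact r.Prime, IsPrimitiveRoot (((-a : ℤ)) : ZMod r) n := by
  by_contra hno
  push Not at hno
  obtain ⟨p, hpm, hmax⟩ := Finset.exists_max_image n.primeFactors id
    (Nat.nonempty_primeFactors.2 (by omega))
  have hp := Nat.prime_of_mem_primeFactors hpm
  have hpn := Nat.dvd_of_mem_primeFactors hpm
  replace hmax : ∀ q : ℕ, q.Prime → q ∣ n → q ≤ p := fun q hq hqn =>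
    hmax q (Nat.mem_primeFactors.2 ⟨hq, hqn, by omega⟩)
  have hlow := zs_lower a ha n p hn hp hpn hmax hex
  have hstep : ∀ r : ℕ, r.Prime → (r : ℤ) ∣ (cyclotomic n ℤ).eval (-a) →
      r = p ∧ (r : ℤ) ∣ (-a) ^ (n / r) - 1 := by
    intro r hr hdvd
    have : Fact r.Prime := ⟨hr⟩
    obtain ⟨k, m, hrm, hnk⟩ := Nat.exists_eq_pow_mul_and_not_dvd (show n ≠ 0 by omega) r hr.ne_one
    have hm0 : m ≠ 0 := by rintro rfl; simp at hrm
    have : NeZero (m : ZMod r) := ⟨by rwa [Ne, ZMod.natCast_eq_zero_iff]⟩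
    have hroot : (cyclotomic n (ZMod r)).IsRoot (((-a : ℤ)) : ZMod r) := by
      rw [IsRoot.def, ← map_cyclotomic_int n (ZMod r), eval_intCast_map]
      simpa using (ZMod.intCast_zmod_eq_zero_iff_dvd _ r).2 hdvd
    rw [hnk, isRoot_cyclotomic_prime_pow_mul_iff_of_charP] at hroot
    rcases k with _ | k
    · rw [pow_zero, one_mul] at hnk
      exact absurd (hnk ▸ hroot) (hno r _)
    have hrn : r ∣ n := hnk ▸ (dvd_pow_self r (by omega)).mul_right m
    have hne : (((-a : ℤ)) : ZMod r) ≠ 0 := hroot.isUnit hm0 |>.ne_zero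
    have hmr : m ∣ r - 1 := (hroot.pow_eq_one_iff_dvd _).1 (ZMod.pow_card_sub_one_eq_one hne)
    refine ⟨?_, ?_⟩
    · apply le_antisymm (hmax r hr hrn)
      rw [hnk] at hpn
      rcases hp.dvd_mul.1 hpn with h | h
      · exact ((Nat.prime_dvd_prime_iff_eq hp hr).1 (hp.dvd_of_dvd_pow h)).le
      · have := Nat.le_of_dvd (by have := hr.two_le; omega) (h.trans hmr)
        omega
    · have hd : m ∣ n / r := by
        rw [hnk, pow_succ', mul_assoc, Nat.mul_div_cancel_left _ hr.pos]
        exact dvd_mul_left _ _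
      have := (hroot.pow_eq_one_iff_dvd _).2 hd
      rw [← ZMod.intCast_zmod_eq_zero_iff_dvd]
      rw [Int.cast_sub, Int.cast_pow, this, Int.cast_one, sub_self]
  set N := (cyclotomic n ℤ).eval (-a) with hN
  have hp2 := hp.two_le
  have hN1 : N.natAbs ≠ 1 := by omega
  obtain ⟨r, hr, hrN⟩ := Nat.exists_prime_and_dvd hN1
  obtain ⟨rfl, hb⟩ := hstep r hr (Int.natCast_dvd.2 hrN)
  obtain ⟨t, ht⟩ := Int.natCast_dvd.2 hrN
  have ht1 : t.natAbs ≠ 1 := by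
    intro h
    rcases Int.natAbs_eq t with h' | h' <;> rw [h'] at ht <;> rw [h] at ht <;> push_cast at ht <;>
      omega
  obtain ⟨s, hs, hst⟩ := Nat.exists_prime_and_dvd ht1
  have hst' := Int.natCast_dvd.2 hst
  obtain ⟨rfl, -⟩ := hstep s hs (ht ▸ hst'.mul_left _)
  refine zs_sq (-a) n s hn hp hpn ?_ (by rw [abs_neg, abs_of_pos] <;> omega) hb ?_
  · rintro rfl
    have := Nat.eq_prime_pow_of_unique_prime_dvd (n := n) (p := 2) (by omega) (by
      intro d hd hdn
      have := hmax d hd hdn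
      have := hd.two_le
      omega)
    generalize n.primeFactorsList.length = l at this
    rcases l with _ | _ | l
    · omega
    · omega
    · rw [pow_succ, pow_succ] at this
      omega
  · rw [← hN, ht, sq]
    exact mul_dvd_mul_left _ hst'

/-- Zsigmondy's (Bang's) theorem, case `ε = -`: for integers `a ≥ 2` and `n ≥ 2`, either
`aⁿ - (-1)ⁿ` has a primitive prime divisor, or `n = 3` and `a = 2`, or `n = 2` and
`a - 1` is a power of `2`. -/
theorem zsigmondy_minus (a : ℤ) (n : ℕ) (ha : 2 ≤ a) (hn : 2 ≤ n) :
    (∃ r : ℕ, r.Prime ∧ (r : ℤ) ∣ a ^ n - (-1) ^ n ∧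
      ∀ i : ℕ, 1 ≤ i → i < n → ¬ (r : ℤ) ∣ a ^ i - (-1) ^ i) ∨
    (n = 3 ∧ a = 2) ∨ (n = 2 ∧ ∃ k : ℕ, a - 1 = 2 ^ k) := by
  have hiff : ∀ (r i : ℕ), (r : ℤ) ∣ a ^ i - (-1) ^ i ↔ (((-a : ℤ)) : ZMod r) ^ i = 1 := by
    intro r i
    have h0 : (((-a : ℤ)) : ZMod r) ^ i = 1 ↔ (((-a) ^ i - 1 : ℤ) : ZMod r) = 0 := by
      rw [Int.cast_sub, Int.cast_pow, Int.cast_one, sub_eq_zero]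
    rw [h0, ZMod.intCast_zmod_eq_zero_iff_dvd]
    have h : (-a) ^ i - 1 = (-1) ^ i * (a ^ i - (-1) ^ i) := by
      rw [neg_pow, mul_sub, ← mul_pow (-1 : ℤ) (-1)]; norm_num
    rw [h]
    rcases neg_one_pow_eq_or ℤ i with h | h <;> rw [h] <;> simp only [one_mul, neg_one_mul, dvd_neg]
  rcases Nat.lt_or_ge 2 n with h3 | h2
  · by_cases hex : n = 3 ∧ a = 2
    · exact Or.inr (Or.inl hex)
    · left
      obtain ⟨r, hr, h⟩ := zs_main a ha n h3 hex
      refine ⟨r, hr.out, (hiff r n).2 h.pow_eq_one, fun i hi hin hd => ?_⟩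
      have := Nat.le_of_dvd (by omega) ((h.pow_eq_one_iff_dvd i).1 ((hiff r i).1 hd))
      omega
  · have hn2 : n = 2 := by omega
    subst hn2
    rcases Nat.eq_two_pow_or_exists_odd_prime_and_dvd (a - 1).natAbs with ⟨k, hk⟩ | ⟨p, hp, hpd, hodd⟩
    · right; right
      refine ⟨rfl, k, ?_⟩
      rw [← Int.natAbs_of_nonneg (show 0 ≤ a - 1 by omega), hk]
      push_cast
      rfl
    · left
      have hd : (p : ℤ) ∣ a - 1 := Int.natCast_dvd.2 hpd
      refine ⟨p, hp, ?_, ?_⟩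
      · rw [show a ^ 2 - (-1) ^ 2 = (a - 1) * (a + 1) by ring]
        exact hd.mul_right _
      · intro i hi hi2 h
        have : i = 1 := by omega
        subst this
        have h2 := dvd_sub h hd
        rw [show a ^ 1 - (-1) ^ 1 - (a - 1) = ((2 : ℕ) : ℤ) by push_cast; ring] at h2
        have := (Nat.prime_dvd_prime_iff_eq hp Nat.prime_two).1 (Int.natCast_dvd_natCast.1 h2)
        subst this
        exact absurd hodd (by decide)
end

section
/- Let q be an odd prime power and let r be an odd prime dividing q² + 1. Let θ be an element of multiplicative order r in the field F_{q⁴} with q⁴ elements. Then there exists a matrix g ∈ SL(4, F_q) whose characteristic polynomial, regarded over F_{q⁴}, equals (X − θ)(X − θ^q)(X − θ^{q²})(X − θ^{q³}); moreover g has order r and ⟨g⟩ ∩ Z(SL(4, F_q)) = 1. -/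
open Matrix Polynomial

/-- For `q` an odd prime power and `r` an odd prime dividing `q² + 1`, there is
`g ∈ SL(4, F_q)` of order `r`, intersecting the center trivially, whose characteristic
polynomial over `F_{q⁴}` is `(X - θ)(X - θ^q)(X - θ^{q²})(X - θ^{q³})` for `θ` of order `r`. -/
theorem sl4_element_order_r4
    (q : ℕ) (hq : Odd q)
    (F : Type) [Field F] [Fintype F] (hF : Fintype.card F = q)
    (E : Type) [Field E] [Fintype E] (hE : Fintype.card E = q ^ 4)
    (f : F →+* E)
    (r : ℕ) (hr : r.Prime) (hrodd : Odd r) (hrdvd : r ∣ q ^ 2 + 1)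
    (θ : E) (hθ : orderOf θ = r) :
    ∃ g : SpecialLinearGroup (Fin 4) F,
      Matrix.charpoly ((g : Matrix (Fin 4) (Fin 4) F).map f) =
        (X - C θ) * (X - C (θ ^ q)) * (X - C (θ ^ q ^ 2)) * (X - C (θ ^ q ^ 3)) ∧
      orderOf g = r ∧
      Subgroup.zpowers g ⊓ Subgroup.center (SpecialLinearGroup (Fin 4) F) = ⊥ := by
  classical
  let _ : Algebra F E := f.toAlgebra
  have hfr : Module.finrank F E = 4 := by
    have h := Module.card_eq_pow_finrank (K := F) (V := E)
    rw [hE, hF] at h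
    have h1 : 1 < q := hF ▸ Fintype.one_lt_card
    exact (Nat.pow_right_injective h1 h).symm
  let b : Module.Basis (Fin 4) F E := Module.finBasisOfFinrankEq F E hfr
  let M : Matrix (Fin 4) (Fin 4) F := Algebra.leftMulMatrix b θ
  have hinj := Algebra.leftMulMatrix_injective b
  -- facts about θ
  have h0 : θ ≠ 0 := by
    rintro rfl
    rw [orderOf_zero] at hθ
    exact hr.ne_zero hθ.symm
  have hinv : θ ^ (q ^ 2 + 1) = 1 := orderOf_dvd_iff_pow_eq_one.1 (hθ ▸ hrdvd)
  have hsq : θ ^ 2 ≠ 1 := by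
    intro h
    have h2 := orderOf_dvd_of_pow_eq_one h
    rw [hθ] at h2
    have := (Nat.prime_dvd_prime_iff_eq hr Nat.prime_two).1 h2
    subst this
    exact absurd hrodd (by decide)
  have hmm : θ ^ q ^ 2 * θ = 1 := by rw [← pow_succ]; exact hinv
  have hmm3 : θ ^ q ^ 3 * θ ^ q = 1 := by
    rw [pow_succ q 2, pow_mul, ← mul_pow, hmm, one_pow]
  have hqq : (θ ^ q) ^ q = θ ^ q ^ 2 := by rw [← pow_mul, sq q]
  have hqqq : (θ ^ q ^ 2) ^ q = θ ^ q ^ 3 := by rw [← pow_mul, ← pow_succ]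
  have n02 : θ ≠ θ ^ q ^ 2 := by
    intro h; rw [← h] at hmm; exact hsq (by rw [sq]; exact hmm)
  have n01 : θ ≠ θ ^ q := by
    intro h; apply n02; rw [← hqq, ← h, ← h]
  have hq4 : (θ ^ q ^ 3) ^ q = θ := by
    rw [← pow_mul, ← pow_succ, ← hE, FiniteField.pow_card]
  have n12 : θ ^ q ≠ θ ^ q ^ 2 := by
    intro h
    have h1 := congrArg (· ^ q) h
    simp only [hqq, hqqq] at h1
    have h2 := congrArg (· ^ q) h1
    simp only [hqqq, hq4] at h2
    exact n02 (h2.symm.trans h1.symm)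
  have n13 : θ ^ q ≠ θ ^ q ^ 3 := by
    intro h
    have h1 := congrArg (· ^ q) h
    simp only [hqq, hq4] at h1
    exact n02 h1.symm
  have n23 : θ ^ q ^ 2 ≠ θ ^ q ^ 3 := by
    intro h
    have h1 := congrArg (· ^ q) h
    simp only [hqqq, hq4] at h1
    exact n02 (by rw [h, h1])
  have n03 : θ ≠ θ ^ q ^ 3 := by
    intro h
    have h1 := congrArg (· ^ q) h
    simp only [hq4] at h1
    exact n01 h1.symm
  -- roots
  have hr0 : aeval θ M.charpoly = 0 := by
    apply hinj
    rw [← aeval_algHom_apply, map_zero]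
    exact Matrix.aeval_self_charpoly M
  have hstep : ∀ x : E, aeval x M.charpoly = 0 → aeval (x ^ q) M.charpoly = 0 := by
    intro x hx
    have := aeval_algHom_apply (FiniteField.frobeniusAlgHom F E) x M.charpoly
    rw [hx, map_zero] at this
    rw [← hF]
    simpa using this
  have hr1 := hstep _ hr0
  have hr2 := hstep _ hr1
  rw [hqq] at hr2
  have hr3 := hstep _ hr2
  rw [hqqq] at hr3
  have hroot : ∀ x : E, aeval x M.charpoly = 0 → (X - C x) ∣ M.charpoly.map f := by
    intro x hx
    rw [dvd_iff_isRoot, IsRoot.def, eval_map]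
    exact hx
  have hcop : ∀ x y : E, x ≠ y → IsCoprime (X - C x) (X - C y) := fun x y h =>
    isCoprime_X_sub_C_of_isUnit_sub (sub_ne_zero.2 h).isUnit
  have hdvd : (X - C θ) * (X - C (θ ^ q)) * (X - C (θ ^ q ^ 2)) * (X - C (θ ^ q ^ 3)) ∣
      M.charpoly.map f := by
    refine IsCoprime.mul_dvd ?_ (IsCoprime.mul_dvd ?_ (IsCoprime.mul_dvd ?_
      (hroot _ hr0) (hroot _ hr1)) (hroot _ hr2)) (hroot _ hr3)
    · exact ((hcop _ _ n03).mul_left (hcop _ _ n13)).mul_left (hcop _ _ n23)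
    · exact (hcop _ _ n02).mul_left (hcop _ _ n12)
    · exact hcop _ _ n01
  have hmon : ((X - C θ) * (X - C (θ ^ q)) * (X - C (θ ^ q ^ 2)) * (X - C (θ ^ q ^ 3))).Monic :=
    (((monic_X_sub_C _).mul (monic_X_sub_C _)).mul (monic_X_sub_C _)).mul (monic_X_sub_C _)
  have hchar : M.charpoly.map f =
      (X - C θ) * (X - C (θ ^ q)) * (X - C (θ ^ q ^ 2)) * (X - C (θ ^ q ^ 3)) := by
    refine (eq_of_monic_of_dvd_of_natDegree_le hmon ((M.charpoly_monic).map f) hdvd ?_)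
    rw [natDegree_map, M.charpoly_natDegree_eq_dim,
      ((((monic_X_sub_C _).mul (monic_X_sub_C _)).mul (monic_X_sub_C _))).natDegree_mul
        (monic_X_sub_C _),
      (((monic_X_sub_C _).mul (monic_X_sub_C _))).natDegree_mul (monic_X_sub_C _),
      (monic_X_sub_C _).natDegree_mul (monic_X_sub_C _)]
    simp only [natDegree_X_sub_C, Fintype.card_fin, le_refl]
  have hdet : M.det = 1 := by
    apply f.injective
    have h := congrArg (eval 0) hchar
    rw [eval_map, eval₂_at_zero] at h
    rw [Matrix.det_eq_sign_charpoly_coeff]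
    simp only [Fintype.card_fin, map_mul, h]
    simp only [eval_mul, eval_sub, eval_X, eval_C]
    have hs : f ((-1) ^ 4) = 1 := by norm_num
    rw [hs, map_one]
    linear_combination (θ ^ q ^ 3 * θ ^ q) * hmm + hmm3
  let g : SpecialLinearGroup (Fin 4) F := ⟨M, hdet⟩
  have hord : orderOf g = r := by
    rw [← hθ, orderOf_eq_orderOf_iff]
    intro n
    rw [← hinj.eq_iff, map_pow, map_one]
    have h1 : g ^ n = 1 ↔ ((g ^ n : Matrix.SpecialLinearGroup (Fin 4) F) :
        Matrix (Fin 4) (Fin 4) F) = (1 : Matrix.SpecialLinearGroup (Fin 4) F) := Subtype.ext_iff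
    rw [h1, Matrix.SpecialLinearGroup.coe_pow, Matrix.SpecialLinearGroup.coe_one]
  refine ⟨g, ?_, ?_, ?_⟩
  · rw [← hchar]
    exact Matrix.charpoly_map M f
  · exact hord
  · have hcard : Nat.card (Subgroup.zpowers g) = r := by rw [Nat.card_zpowers, hord]
    have : Fact (Nat.card (Subgroup.zpowers g)).Prime := ⟨hcard ▸ hr⟩
    rcases Subgroup.eq_bot_or_eq_top_of_prime_card
      ((Subgroup.center (SpecialLinearGroup (Fin 4) F)).subgroupOf (Subgroup.zpowers g)) with h | h
    · rw [Subgroup.subgroupOf_eq_bot] at h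
      exact h.symm.eq_bot
    · exfalso
      rw [Subgroup.subgroupOf_eq_top] at h
      have hg := h (Subgroup.mem_zpowers g)
      obtain ⟨c, -, hc⟩ := Matrix.SpecialLinearGroup.mem_center_iff.1 hg
      have hc' : algebraMap F E c = θ := by
        apply hinj
        rw [AlgHom.commutes]
        exact hc
      apply n01
      rw [← hc', ← map_pow, ← hF, FiniteField.pow_card]
end

section
/- Let q be an odd prime power and let r be a prime dividing q² + q + 1 but not dividing q − 1. Let θ be an element of multiplicative order r in the field F_{q³} with q³ elements. Then there exists a matrix g ∈ SL(4, F_q) whose characteristic polynomial, regarded over F_{q³}, equals (X − 1)(X − θ)(X − θ^q)(X − θ^{q²}); moreover g has order r and ⟨g⟩ ∩ Z(SL(4, F_q)) = 1. -/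
open Matrix Polynomial

/-- The explicit matrix: `1` plus a companion block. -/
def sl4aux {R : Type} [CommRing R] (α β : R) : Matrix (Fin 4) (Fin 4) R :=
  !![1,0,0,0; 0,0,0,1; 0,1,0,-β; 0,0,1,α]

theorem sl4aux_det {R : Type} [CommRing R] (α β : R) : (sl4aux α β).det = 1 := by
  simp [sl4aux, Matrix.det_succ_row_zero, Fin.sum_univ_succ, Fin.succAbove]

theorem sl4aux_charpoly {R : Type} [CommRing R] (α β : R) :
    (sl4aux α β).charpoly = (X - 1) * (X ^ 3 - C α * X ^ 2 + C β * X - 1) := by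
  have h : (sl4aux α β).charmatrix =
      !![X - 1,0,0,0; 0,X,0,-1; 0,-1,X,C β; 0,0,-1,X - C α] := by
    ext i j : 2
    fin_cases i <;> fin_cases j <;> simp [sl4aux, Matrix.charmatrix_apply]
  rw [Matrix.charpoly, h]
  simp [Matrix.det_succ_row_zero, Fin.sum_univ_succ, Fin.succAbove]
  ring

theorem mem_range_of_pow_card {F E : Type} [Field F] [Fintype F] [Field E]
    (f : F →+* E) (x : E) (hx : x ^ Fintype.card F = x) : ∃ y, f y = x := by
  classical
  by_contra hne
  have hc : 1 < Fintype.card F := Fintype.one_lt_card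
  have hp : (X ^ Fintype.card F - X : E[X]) ≠ 0 := FiniteField.X_pow_card_sub_X_ne_zero E hc
  have hd := FiniteField.X_pow_card_sub_X_natDegree_eq E hc
  have hsub : insert x (Finset.univ.image f) ⊆ (X ^ Fintype.card F - X : E[X]).roots.toFinset := by
    intro z hz
    rw [Multiset.mem_toFinset, mem_roots hp]
    simp only [Finset.mem_insert, Finset.mem_image, Finset.mem_univ, true_and] at hz
    rcases hz with rfl | ⟨y, rfl⟩
    · simp [hx]
    · simp [← map_pow, FiniteField.pow_card]
  have h1 := Finset.card_le_card hsub
  rw [Finset.card_insert_of_notMem (by simpa using hne),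
    Finset.card_image_of_injective _ f.injective, Finset.card_univ] at h1
  have h2 := Multiset.toFinset_card_le (X ^ Fintype.card F - X : E[X]).roots
  have h3 := card_roots' (X ^ Fintype.card F - X : E[X])
  omega

theorem sl4_element_order_r3
    (q : ℕ) (hq : Odd q)
    (F : Type) [Field F] [Fintype F] (hF : Fintype.card F = q)
    (E : Type) [Field E] [Fintype E] (hE : Fintype.card E = q ^ 3)
    (f : F →+* E)
    (r : ℕ) (hr : r.Prime) (hrdvd : r ∣ q ^ 2 + q + 1) (hrnd : ¬ r ∣ q - 1)
    (θ : E) (hθ : orderOf θ = r) :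
    ∃ g : SpecialLinearGroup (Fin 4) F,
      Matrix.charpoly ((g : Matrix (Fin 4) (Fin 4) F).map f) =
        (X - 1) * (X - C θ) * (X - C (θ ^ q)) * (X - C (θ ^ q ^ 2)) ∧
      orderOf g = r ∧
      Subgroup.zpowers g ⊓ Subgroup.center (SpecialLinearGroup (Fin 4) F) = ⊥ := by
  have hq0 : 1 < q := hF ▸ Fintype.one_lt_card
  have hθr : θ ^ r = 1 := hθ ▸ pow_orderOf_eq_one θ
  have hθ1 : θ ≠ 1 := by
    rintro rfl
    rw [orderOf_one] at hθ
    exact hr.one_lt.ne hθ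
  have hθ0 : θ ≠ 0 := by
    rintro rfl
    simp [hr.ne_zero] at hθr
  have hfrob : ∀ x : E, x ^ q ^ 3 = x := fun x => hE ▸ FiniteField.pow_card x
  have hinj : ∀ x y : E, x ^ q = y ^ q → x = y := by
    intro x y h
    rw [← hfrob x, ← hfrob y, pow_succ', pow_mul, pow_mul, h]
  have hnorm : θ * θ ^ q * θ ^ q ^ 2 = 1 := by
    have : θ ^ (q ^ 2 + q + 1) = 1 := orderOf_dvd_iff_pow_eq_one.1 (hθ ▸ hrdvd)
    rw [← this]; ring
  have hsucc : (θ ^ q ^ 2) ^ q = θ := by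
    rw [← pow_mul, ← pow_succ, hfrob]
  have hsq : (θ ^ q) ^ q = θ ^ q ^ 2 := by rw [← pow_mul, sq]
  have hθq : θ ^ q ≠ θ := by
    intro h
    apply hrnd
    rw [← hθ, orderOf_dvd_iff_pow_eq_one]
    have h' : θ ^ (q - 1) * θ = 1 * θ := by
      rw [← pow_succ, Nat.sub_add_cancel hq0.le, h, one_mul]
    exact mul_right_cancel₀ hθ0 h'
  have hθqq : θ ^ q ^ 2 ≠ θ ^ q := by
    rw [← hsq]; exact fun h => hθq (hinj _ _ h)
  have hθqq' : θ ^ q ^ 2 ≠ θ := by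
    intro h
    rw [h] at hsucc
    exact hθq hsucc
  have h1q : θ ^ q ≠ 1 := fun h => hθ1 (hinj _ _ (by simpa using h))
  have h1qq : θ ^ q ^ 2 ≠ 1 := by
    rw [← hsq]; exact fun h => h1q (hinj _ _ (by simpa using h))
  -- additivity of the q-power map
  have hadd : ∀ x y : E, (x + y) ^ q = x ^ q + y ^ q := by
    letI := f.toAlgebra
    intro x y
    have := (FiniteField.frobeniusAlgHom F E).map_add x y
    simpa [hF] using this
  obtain ⟨α, hα⟩ := mem_range_of_pow_card f (θ + θ ^ q + θ ^ q ^ 2) (by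
    rw [hF, hadd, hadd, hsucc, hsq]; ring)
  obtain ⟨β, hβ⟩ := mem_range_of_pow_card f (θ * θ ^ q + θ * θ ^ q ^ 2 + θ ^ q * θ ^ q ^ 2) (by
    rw [hF, hadd, hadd, mul_pow, mul_pow, mul_pow, hsucc, hsq]; ring)
  have hmap : (sl4aux α β).map f = sl4aux (f α) (f β) := by
    ext i j
    fin_cases i <;> fin_cases j <;> simp [sl4aux]
  have hcp : ((sl4aux α β).map f).charpoly =
      (X - 1) * (X - C θ) * (X - C (θ ^ q)) * (X - C (θ ^ q ^ 2)) := by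
    rw [hmap, sl4aux_charpoly, hα, hβ]
    have hC : (C θ * C (θ ^ q) * C (θ ^ q ^ 2) : E[X]) = 1 := by
      rw [← C_mul, ← C_mul, hnorm, C_1]
    simp only [C_add, C_mul]
    linear_combination (X - 1) * hC
  have hdvd : (X - 1) * (X - C θ) * (X - C (θ ^ q)) * (X - C (θ ^ q ^ 2)) ∣ (X ^ r - 1 : E[X]) := by
    have hlin : ∀ a : E, a ^ r = 1 → X - C a ∣ (X ^ r - 1 : E[X]) := by
      intro a ha
      rw [dvd_iff_isRoot]
      simp [ha]
    have hco : ∀ a b : E, a ≠ b → IsCoprime (X - C a) (X - C b) := fun a b h =>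
      isCoprime_X_sub_C_of_isUnit_sub (sub_ne_zero.2 h).isUnit
    have hpr : ∀ n : ℕ, (θ ^ n) ^ r = 1 := fun n => by rw [pow_right_comm, hθr, one_pow]
    rw [← C_1 (R := E)]
    refine IsCoprime.mul_dvd ?_ (IsCoprime.mul_dvd ?_ (IsCoprime.mul_dvd ?_ ?_ ?_) ?_) ?_
    · exact ((hco _ _ h1qq.symm).mul_left (hco _ _ hθqq'.symm)).mul_left (hco _ _ hθqq.symm)
    · exact (hco _ _ h1q.symm).mul_left (hco _ _ hθq.symm)
    · exact hco _ _ hθ1.symm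
    · exact hlin _ (one_pow r)
    · exact hlin _ hθr
    · exact hlin _ (hpr q)
    · exact hlin _ (hpr _)
  have hpowE : ((sl4aux α β).map f) ^ r = 1 := by
    rw [← hcp] at hdvd
    obtain ⟨c, hc⟩ := hdvd
    have := congrArg (aeval ((sl4aux α β).map f)) hc
    rw [map_mul, Matrix.aeval_self_charpoly, zero_mul] at this
    simpa [sub_eq_zero] using this
  have hpow : (sl4aux α β) ^ r = 1 := by
    apply Matrix.map_injective f.injective
    have h1 : ((sl4aux α β) ^ r).map f = ((sl4aux α β).map f) ^ r :=
      map_pow f.mapMatrix (sl4aux α β) r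
    have h2 : (1 : Matrix (Fin 4) (Fin 4) F).map f = 1 := map_one f.mapMatrix
    show ((sl4aux α β) ^ r).map f = (1 : Matrix (Fin 4) (Fin 4) F).map f
    rw [h1, h2, hpowE]
  obtain ⟨g, hgM⟩ : ∃ g : SpecialLinearGroup (Fin 4) F,
      (g : Matrix (Fin 4) (Fin 4) F) = sl4aux α β := ⟨⟨sl4aux α β, sl4aux_det α β⟩, rfl⟩
  have hnc : g ∉
      Subgroup.center (SpecialLinearGroup (Fin 4) F) := by
    intro h
    obtain ⟨c, -, hc⟩ := Matrix.SpecialLinearGroup.mem_center_iff.1 h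
    have := congrFun (congrFun hc 2) 1
    rw [hgM] at this
    simp [sl4aux] at this
  have hord : orderOf g = r := by
    haveI : Fact r.Prime := ⟨hr⟩
    apply orderOf_eq_prime
    · apply Subtype.ext
      simpa [hgM] using hpow
    · intro h
      exact hnc (h ▸ Subgroup.one_mem _)
  refine ⟨g, hgM ▸ hcp, hord, ?_⟩
  have hcard : Nat.card (Subgroup.zpowers g) = r := by rw [Nat.card_zpowers, hord]
  have hle : Subgroup.zpowers g ⊓ Subgroup.center (SpecialLinearGroup (Fin 4) F) ≤
    Subgroup.zpowers g := inf_le_left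
  have hd := Subgroup.card_dvd_of_le hle
  rw [hcard] at hd
  rcases (Nat.dvd_prime hr).1 hd with h | h
  · exact Subgroup.card_eq_one.1 h
  · exfalso
    have := Subgroup.eq_of_le_of_card_ge hle (by rw [hcard, h])
    have hg : g ∈ Subgroup.zpowers g := Subgroup.mem_zpowers g
    rw [← this] at hg
    exact hnc hg.2
end

section
/- Let q be a prime power with q ≡ 3 (mod 4) and set t = (q² − 1)₂, the 2-part of q² − 1. Then there exists a matrix g ∈ SL(4, F_q) of order t such that ⟨g⟩ ∩ Z(SL(4, F_q)) = 1. Such a g may be chosen so that its characteristic polynomial, regarded over F_{q²}, equals (X − θ)(X − θ^q)(X + 1)(X − 1), where θ ∈ F_{q²} has multiplicative order t. -/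
open Matrix Polynomial

/-- The 2-part of a natural number: the highest power of `2` dividing it. -/
def twoPart (n : ℕ) : ℕ := 2 ^ padicValNat 2 n

lemma aux_arith (q : ℕ) (hq : q % 4 = 3) :
    twoPart (q ^ 2 - 1) = 2 * twoPart (q + 1) ∧ twoPart (q ^ 2 - 1) ∣ 2 * (q + 1) ∧
    ¬ twoPart (q ^ 2 - 1) ∣ (q + 1) ∧ ¬ twoPart (q ^ 2 - 1) ∣ (q - 1) ∧
    twoPart (q ^ 2 - 1) ∣ q ^ 2 - 1 := by
  have h1 : q ^ 2 - 1 = (q - 1) * (q + 1) := by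
    obtain ⟨m, rfl⟩ : ∃ m, q = m + 1 := ⟨q - 1, by omega⟩
    simp only [Nat.add_sub_cancel]
    apply Nat.sub_eq_of_eq_add; ring
  have h2 : padicValNat 2 (q - 1) = 1 := by
    obtain ⟨m, hm⟩ : ∃ m, q - 1 = 2 * m := ⟨(q - 1) / 2, by omega⟩
    rw [hm, padicValNat.mul (by norm_num) (by omega), padicValNat.self (by norm_num),
      padicValNat.eq_zero_of_not_dvd (by omega)]
  have h3 : twoPart (q ^ 2 - 1) = 2 * twoPart (q + 1) := by
    unfold twoPart
    rw [h1, padicValNat.mul (by omega) (by omega), h2, pow_add, pow_one]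
  have h4 : 4 ∣ q + 1 := by omega
  have h5 : 4 ∣ twoPart (q + 1) := by
    have : 2 ^ 2 ∣ q + 1 := by simpa using h4
    exact pow_dvd_pow 2 ((padicValNat_dvd_iff_le (by omega)).1 this)
  refine ⟨h3, ?_, ?_, ?_, pow_padicValNat_dvd⟩
  · rw [h3]; exact Nat.mul_dvd_mul_left 2 pow_padicValNat_dvd
  · rw [h3, twoPart, mul_comm, ← pow_succ]
    exact pow_succ_padicValNat_not_dvd (by omega)
  · rw [h3]; intro h
    have : 4 ∣ q - 1 := (h5.trans (Dvd.intro_left _ rfl)).trans h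
    omega

lemma aux_theta (n t : ℕ) (E : Type) [Field E] [Fintype E] (hE : Fintype.card E = n + 1)
    (hn : n ≠ 0) (ht : t ∣ n) : ∃ θ : E, orderOf θ = t := by
  obtain ⟨u, hu⟩ := IsCyclic.exists_ofOrder_eq_natCard (α := Eˣ)
  have hc : orderOf u = n := by
    classical
    rw [hu, Nat.card_eq_fintype_card, Fintype.card_units, hE]; simp
  refine ⟨((u ^ (orderOf u / t) : Eˣ) : E), ?_⟩
  rw [orderOf_units, orderOf_pow_orderOf_div (by omega) (by rw [hc]; exact ht)]

lemma aux_range (q : ℕ) (hq : 1 < q)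
    (F : Type) [Field F] [Fintype F] (hF : Fintype.card F = q)
    (E : Type) [Field E] [Fintype E] (f : F →+* E) (x : E) (hx : x ^ q = x) :
    ∃ s, f s = x := by
  classical
  have h0 : (X ^ q - X : E[X]) ≠ 0 := FiniteField.X_pow_card_sub_X_ne_zero E hq
  have h : Finset.univ.image f = (X ^ q - X : E[X]).roots.toFinset := by
    apply Finset.eq_of_subset_of_card_le
    · intro y hy
      obtain ⟨a, -, rfl⟩ := Finset.mem_image.1 hy
      rw [Multiset.mem_toFinset, mem_roots h0]
      simp [← map_pow, ← hF, FiniteField.pow_card]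
    · rw [Finset.card_image_of_injective _ f.injective, Finset.card_univ, hF]
      refine (Multiset.toFinset_card_le _).trans ((card_roots' _).trans ?_)
      rw [FiniteField.X_pow_card_sub_X_natDegree_eq E hq]
  have : x ∈ Finset.univ.image f := by
    rw [h, Multiset.mem_toFinset, mem_roots h0]
    simp [hx]
  obtain ⟨a, -, ha⟩ := Finset.mem_image.1 this
  exact ⟨a, ha⟩

lemma aux_add (q : ℕ) (F : Type) [Field F] [Fintype F] (hF : Fintype.card F = q)
    (E : Type) [Field E] (f : F →+* E) (x y : E) : (x + y) ^ q = x ^ q + y ^ q := by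
  let _ := f.toAlgebra
  subst hF
  exact map_add (FiniteField.frobeniusAlgHom F E) x y

/-- For `q ≡ 3 (mod 4)` a prime power and `t = (q² - 1)₂`, there is `g ∈ SL(4, F_q)` of
order `t` intersecting the center trivially; moreover `g` may be chosen with
characteristic polynomial `(X - θ)(X - θ^q)(X + 1)(X - 1)` over `F_{q²}`, where
`θ ∈ F_{q²}` has multiplicative order `t`. -/
theorem sl4_element_order_twoPart
    (q : ℕ) (hq : q % 4 = 3)
    (F : Type) [Field F] [Fintype F] (hF : Fintype.card F = q)
    (E : Type) [Field E] [Fintype E] (hE : Fintype.card E = q ^ 2)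
    (f : F →+* E) :
    ∃ g : SpecialLinearGroup (Fin 4) F,
      orderOf g = twoPart (q ^ 2 - 1) ∧
      Subgroup.zpowers g ⊓ Subgroup.center (SpecialLinearGroup (Fin 4) F) = ⊥ ∧
      ∃ θ : E, orderOf θ = twoPart (q ^ 2 - 1) ∧
        Matrix.charpoly ((g : Matrix (Fin 4) (Fin 4) F).map f) =
          (X - C θ) * (X - C (θ ^ q)) * (X + 1) * (X - 1) := by
  obtain ⟨-, a2, a3, a4, a5⟩ := aux_arith q hq
  have hq1 : q ^ 2 - 1 + 1 = q ^ 2 := Nat.sub_add_cancel (Nat.one_le_pow _ _ (by omega))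
  have hq2 : q ^ 2 - 1 ≠ 0 := by
    have : 2 ^ 2 ≤ q ^ 2 := Nat.pow_le_pow_left (by omega) 2
    omega
  obtain ⟨θ, hθ⟩ := aux_theta (q ^ 2 - 1) _ E (by rw [hE, hq1]) hq2 a5
  rw [← hθ] at a2 a3 a4 a5 ⊢
  have hθ0 : θ ≠ 0 := by
    rintro rfl
    exact hq2 (by simpa using a5)
  have hN : θ ^ (q + 1) = -1 := by
    have h1 : (θ ^ (q + 1)) ^ 2 = 1 := by
      rw [← pow_mul, mul_comm]; exact orderOf_dvd_iff_pow_eq_one.1 a2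
    rcases mul_self_eq_one_iff.1 ((pow_two _).symm.trans h1) with h | h
    · exact absurd (orderOf_dvd_of_pow_eq_one h) a3
    · exact h
  have hne : θ ^ q - θ ≠ 0 := by
    intro h
    apply a4
    apply orderOf_dvd_of_pow_eq_one
    apply mul_right_cancel₀ hθ0
    rw [← pow_succ, Nat.sub_add_cancel (by omega), one_mul]
    exact sub_eq_zero.1 h
  obtain ⟨s, hs⟩ := aux_range q (by omega) F hF E f (θ + θ ^ q) (by
    rw [aux_add q F hF E f, ← pow_mul, ← pow_two, ← hE, FiniteField.pow_card, add_comm])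
  have hN' : θ * θ ^ q = -1 := by rw [← hN, pow_succ, mul_comm]
  let M : Matrix (Fin 4) (Fin 4) F := !![0, 1, 0, 0; 1, s, 0, 0; 0, 0, -1, 0; 0, 0, 0, 1]
  have hM : M.det = 1 := by
    simp [M, Matrix.det_succ_row_zero, Fin.sum_univ_succ, Fin.succAbove]
  let V : Matrix (Fin 4) (Fin 4) E :=
    !![1, 1, 0, 0; θ, θ ^ q, 0, 0; 0, 0, 1, 0; 0, 0, 0, 1]
  have hV : V.det = θ ^ q - θ := by
    simp [V, Matrix.det_succ_row_zero, Fin.sum_univ_succ, Fin.succAbove]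
    try ring
  let d : Fin 4 → E := ![θ, θ ^ q, -1, 1]
  have hVu : IsUnit V := (Matrix.isUnit_iff_isUnit_det V).2 (by rw [hV]; exact hne.isUnit)
  have hMV : (M.map f) * V = V * diagonal d := by
    ext i j
    fin_cases i <;> fin_cases j <;>
      simp [M, V, d, Matrix.mul_apply, Fin.sum_univ_succ, hs] <;> linear_combination hN'
  have hpow : ∀ n : ℕ, (M ^ n).map f * V = V * diagonal (d ^ n) := by
    intro n
    have : (M ^ n).map f = (M.map f) ^ n := map_pow (f.mapMatrix (m := Fin 4)) M n
    rw [this, ← Matrix.diagonal_pow]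
    exact (SemiconjBy.pow_right (show SemiconjBy V (diagonal d) (M.map f) from hMV.symm) n).symm
  have key : ∀ n : ℕ, M ^ n = 1 ↔ d ^ n = 1 := by
    intro n
    constructor
    · intro h
      have h1 := hpow n
      rw [h, Matrix.map_one f (map_zero f) (map_one f), one_mul] at h1
      have h2 : V * diagonal (d ^ n) = V * 1 := by rw [← h1, mul_one]
      have h3 := hVu.mul_left_cancel h2
      rw [← Matrix.diagonal_one] at h3
      exact Matrix.diagonal_injective h3
    · intro h
      have h1 := hpow n
      rw [h, Matrix.diagonal_one' , mul_one] at h1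
      have h2 := hVu.mul_right_cancel (h1.trans (one_mul V).symm)
      apply Matrix.map_injective f.injective
      change (M ^ n).map f = (1 : Matrix (Fin 4) (Fin 4) F).map f
      rw [h2, Matrix.map_one f (map_zero f) (map_one f)]
  have key2 : ∀ n : ℕ, d ^ n = 1 ↔ θ ^ n = 1 := by
    intro n
    constructor
    · intro h
      simpa [d] using congrFun h 0
    · intro h
      funext i
      fin_cases i
      · simpa [d] using h
      · simp [d, ← pow_mul, mul_comm q n]; simp [pow_mul, h]
      · simp [d, ← hN, ← pow_mul, mul_comm _ n]; simp [pow_mul, h]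
      · simp [d]
  let g : SpecialLinearGroup (Fin 4) F := ⟨M, hM⟩
  have hgc : ∀ n : ℕ, ((g ^ n : Matrix.SpecialLinearGroup (Fin 4) F) :
      Matrix (Fin 4) (Fin 4) F) = M ^ n := fun n => Matrix.SpecialLinearGroup.coe_pow g n
  have hg : ∀ n : ℕ, g ^ n = 1 ↔ M ^ n = 1 := by
    intro n
    constructor
    · intro h
      rw [← hgc, h]; rfl
    · intro h
      apply Subtype.ext
      exact (hgc n).trans h
  refine ⟨g, ?_, ?_, θ, rfl, ?_⟩
  · rw [orderOf_eq_orderOf_iff]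
    intro n
    rw [hg, key, key2]
  · rw [eq_bot_iff]
    rintro x ⟨hx1, hx2⟩
    have hx1' : x ∈ Submonoid.powers g := mem_powers_iff_mem_zpowers.2 hx1
    obtain ⟨n, rfl⟩ := hx1'
    rw [Subgroup.mem_bot]
    obtain ⟨r, -, hr⟩ := Matrix.SpecialLinearGroup.mem_center_iff.1 hx2
    have hr' : scalar (Fin 4) r = M ^ n := by rw [hr]; exact hgc n
    have h1 := hpow n
    have h3 := congrFun (congrFun h1 3) 3
    rw [← hr'] at h3
    have h4 : r = 1 := by
      apply f.injective
      simpa [V, d, Matrix.mul_apply, Fin.sum_univ_succ, diagonal] using h3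
    rw [hg, ← hr', h4, map_one]
  · have : (X - C θ) * (X - C (θ ^ q)) = X ^ 2 - C (f s) * X - 1 := by
      have h : (C θ * C (θ ^ q) : E[X]) = -1 := by rw [← C_mul, hN']; simp
      rw [hs, C_add]
      linear_combination h
    rw [this]
    simp [g, M, Matrix.charpoly, Matrix.charmatrix, Matrix.det_succ_row_zero, Fin.sum_univ_succ,
      Fin.succAbove]
    ring
end
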